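/- arXiv:0810.4609 — 2 statements merged into one kernel-verified Lean document; each statement's English description precedes it below -/
import Mathlib

section
/- Let 𝒳 be a separable real Hilbert space, (P_t)_{t≥0} a Feller Markov transition semigroup on 𝒳, 𝒦 ⊆ 𝒳 a compact set, and z ∈ 𝒳 a point such that for every x ∈ 𝒦 there exists t_x > 0 with z ∈ supp(P_{t_x}*δ_x). Then for every δ > 0 there exist a finite set S of positive reals and r̃ > 0 such that inf_{x ∈ 𝒦 + r̃B(0,1)} max_{s∈S} P_s(x, B(z,δ)) > 0. -/
open MeasureTheory Filter Topology Metric Set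

noncomputable section

/-- A Markov transition semigroup on a measurable space `X`: a jointly measurable family
of Markov probability kernels `P t x` with `P 0 x = δ_x` and the Chapman–Kolmogorov
semigroup property for nonnegative times. -/
structure MarkovSemigroup (X : Type*) [MeasurableSpace X] where
  P : ℝ → X → MeasureTheory.Measure X
  prob : ∀ t x, MeasureTheory.IsProbabilityMeasure (P t x)
  meas : Measurable fun p : ℝ × X => P p.1 p.2
  init : ∀ x : X, P 0 x = MeasureTheory.Measure.dirac x
  semigroup : ∀ t s : ℝ, 0 ≤ t → 0 ≤ s → ∀ x : X,
    P (t + s) x = (P t x).bind (P s)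

namespace MarkovSemigroup

variable {X : Type*} [MeasurableSpace X]

/-- Action `P_t f(x) = ∫ f(y) P_t(x,dy)` on functions. -/
def act (M : MarkovSemigroup X) (t : ℝ) (f : X → ℝ) (x : X) : ℝ :=
  ∫ y, f y ∂(M.P t x)

/-- Dual action `P_t^* μ` on measures. -/
def dual (M : MarkovSemigroup X) (t : ℝ) (μ : MeasureTheory.Measure X) :
    MeasureTheory.Measure X :=
  μ.bind (M.P t)

/-- The time average `Q^T μ = (1/T) ∫_0^T P_s^* μ ds` (with the convention
`Q^T μ = μ` for `T ≤ 0`). -/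
def QM (M : MarkovSemigroup X) (T : ℝ) (μ : MeasureTheory.Measure X) :
    MeasureTheory.Measure X :=
  if T ≤ 0 then μ
  else ((ENNReal.ofReal (1 / T)) • (volume.restrict (Set.Ioc (0 : ℝ) T))).bind
    fun s => M.dual s μ

/-- `Q^T(x,·) := Q^T δ_x`. -/
def Q (M : MarkovSemigroup X) (T : ℝ) (x : X) : MeasureTheory.Measure X :=
  M.QM T (MeasureTheory.Measure.dirac x)

/-- Iterated averages: for `ts = [t_k, …, t_1]`, `QMs ts μ = Q^{t_k}(⋯(Q^{t_1} μ)⋯)`. -/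
def QMs (M : MarkovSemigroup X) (ts : List ℝ) (μ : MeasureTheory.Measure X) :
    MeasureTheory.Measure X :=
  ts.foldr (fun t ν => M.QM t ν) μ

/-- A measure is invariant if `P_t^* μ = μ` for all `t ≥ 0`. -/
def Invariant (M : MarkovSemigroup X) (μ : MeasureTheory.Measure X) : Prop :=
  ∀ t : ℝ, 0 ≤ t → M.dual t μ = μ

section TopologicalDefs

variable [TopologicalSpace X]

/-- Bounded continuous real functions. -/
def IsBddContinuous (f : X → ℝ) : Prop :=
  Continuous f ∧ ∃ C : ℝ, ∀ x, |f x| ≤ C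

/-- The Feller property: `P_t` maps bounded continuous functions to continuous ones. -/
def Feller (M : MarkovSemigroup X) : Prop :=
  ∀ t : ℝ, 0 ≤ t → ∀ f : X → ℝ, MarkovSemigroup.IsBddContinuous f →
    Continuous (M.act t f)

/-- Stochastic continuity: `P_t f(x) → f(x)` as `t → 0+`. -/
def StochasticallyContinuous (M : MarkovSemigroup X) : Prop :=
  ∀ f : X → ℝ, MarkovSemigroup.IsBddContinuous f → ∀ x : X,
    Filter.Tendsto (fun t : ℝ => M.act t f x) (nhdsWithin 0 (Set.Ioi 0)) (nhds (f x))

/-- Weak convergence of `Q^T ν` to `μ` as `T → ∞`. -/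
def QTendsto (M : MarkovSemigroup X) (ν μ : MeasureTheory.Measure X) : Prop :=
  ∀ f : X → ℝ, MarkovSemigroup.IsBddContinuous f →
    Filter.Tendsto (fun T : ℝ => ∫ x, f x ∂(M.QM T ν)) Filter.atTop
      (nhds (∫ x, f x ∂μ))

/-- Weak-* mean ergodicity with limit `μstar`. -/
def WeakStarMeanErgodic (M : MarkovSemigroup X) (μstar : MeasureTheory.Measure X) : Prop :=
  ∀ ν : MeasureTheory.Measure X, MeasureTheory.IsProbabilityMeasure ν → M.QTendsto ν μstar

/-- Tightness of the family `(Q^T(x,·))_{T>0}`. -/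
def TightAt (M : MarkovSemigroup X) (x : X) : Prop :=
  ∀ ε : ℝ, 0 < ε → ∃ K : Set X, IsCompact K ∧
    ∀ T : ℝ, 0 < T → 1 - ε ≤ ((M.Q T x) K).toReal

end TopologicalDefs

end MarkovSemigroup

/-- Topological support of a measure: points all of whose open neighborhoods
have positive mass. -/
def msupport {X : Type*} [MeasurableSpace X] [TopologicalSpace X]
    (μ : MeasureTheory.Measure X) : Set X :=
  {x : X | ∀ U : Set X, IsOpen U → x ∈ U → 0 < μ U}

/-- Total variation distance between two (finite) measures, as the supremum over
Borel sets of the discrepancy of masses. -/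
def tvDist {X : Type*} [MeasurableSpace X] (μ ν : MeasureTheory.Measure X) : ℝ :=
  ⨆ B : {B : Set X // MeasurableSet B}, |(μ B.1).toReal - (ν B.1).toReal|

section MetricDefs

variable {X : Type*} [MeasurableSpace X] [PseudoMetricSpace X]

/-- Bounded Lipschitz real functions. -/
def IsBddLipschitz (ψ : X → ℝ) : Prop :=
  (∃ K : NNReal, LipschitzWith K ψ) ∧ ∃ C : ℝ, ∀ x, |ψ x| ≤ C

/-- The e-property: equicontinuity of `(P_t ψ)_{t ≥ 0}` at every point, for every
bounded Lipschitz `ψ`. -/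
def MarkovSemigroup.EProperty (M : MarkovSemigroup X) : Prop :=
  ∀ ψ : X → ℝ, IsBddLipschitz ψ → ∀ x : X, ∀ ε : ℝ, 0 < ε →
    ∃ δ : ℝ, 0 < δ ∧ ∀ z : X, dist z x < δ → ∀ t : ℝ, 0 ≤ t →
      |M.act t ψ z - M.act t ψ x| < ε

end MetricDefs

/-- A continuous tent function supported in `Metric.ball z δ` bounds the mass of the ball from
below, so by the Feller property the mass is locally bounded away from zero. -/
theorem MarkovSemigroup.Feller.exists_eventually_le_measure_ball
    {X : Type*} [PseudoMetricSpace X] [MeasurableSpace X] [BorelSpace X]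
    {M : MarkovSemigroup X} (hFeller : M.Feller) {t : ℝ} (ht : 0 ≤ t) {x z : X}
    (hz : z ∈ msupport (M.P t x)) {δ : ℝ} (hδ : 0 < δ) :
    ∃ c : ℝ, 0 < c ∧ ∀ᶠ y in 𝓝 x, ENNReal.ofReal c ≤ M.P t y (Metric.ball z δ) := by
  have := M.prob
  set f : X → ℝ := fun y => max 0 (1 - dist y z / δ) with hf
  have hf0 : ∀ y, 0 ≤ f y := fun y => le_max_left _ _
  have hf1 : ∀ y, f y ≤ 1 := fun y =>
    max_le zero_le_one (sub_le_self _ (by positivity))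
  have hfc : Continuous f := by fun_prop
  have hfb : ∀ y, |f y| ≤ 1 := fun y => by rw [abs_of_nonneg (hf0 y)]; exact hf1 y
  have hint : ∀ y, Integrable f (M.P t y) := fun y =>
    Integrable.of_bound hfc.measurable.aestronglyMeasurable 1 (ae_of_all _ hfb)
  have hle : ∀ y, M.act t f y ≤ (M.P t y).real (Metric.ball z δ) := fun y => by
    rw [← integral_indicator_one measurableSet_ball]
    refine integral_mono (hint y) ((integrable_const 1).indicator measurableSet_ball) fun w => ?_
    by_cases hw : w ∈ Metric.ball z δ
    · simpa [Set.indicator_of_mem hw] using hf1 w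
    · have hdist : 1 ≤ dist w z / δ := by
        rw [one_le_div hδ]
        simpa using hw
      rw [Set.indicator_of_notMem hw]
      exact max_le le_rfl (by linarith)
  have hpos : 0 < M.act t f x := by
    refine (integral_pos_iff_support_of_nonneg hf0 (hint x)).2 ?_
    refine hz _ hfc.isOpen_support ?_
    simp [hf]
  refine ⟨M.act t f x / 2, half_pos hpos, ?_⟩
  filter_upwards [(hFeller t ht f ⟨hfc, 1, hfb⟩).continuousAt.eventually
    (lt_mem_nhds (half_lt_self hpos))] with y hy
  exact ENNReal.ofReal_le_of_le_toReal (hy.le.trans (hle y))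

/-- Step IV of the proof of Theorem 3. On a separable Hilbert space,
for a Feller semigroup, a compact set `𝒦`, and a point `z` lying in the support of some
`P_{t_x}^* δ_x` for every `x ∈ 𝒦`, for every `δ > 0` there are a finite set `S` of
positive times and `r̃ > 0` with
`inf_{x ∈ 𝒦 + r̃B(0,1)} max_{s∈S} P_s 𝟙_{B(z,δ)}(x) > 0`. -/
theorem exists_finite_times_with_uniform_mass
    {X : Type*} [NormedAddCommGroup X] [InnerProductSpace ℝ X] [CompleteSpace X]
    [SecondCountableTopology X] [MeasurableSpace X] [BorelSpace X]
    (M : MarkovSemigroup X) (hFeller : M.Feller)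
    (K : Set X) (hKcpt : IsCompact K)
    (z : X)
    (hz : ∀ x ∈ K, ∃ t : ℝ, 0 < t ∧ z ∈ msupport (M.P t x)) :
    ∀ δ : ℝ, 0 < δ →
      ∃ S : Finset ℝ, S.Nonempty ∧ (∀ s ∈ S, (0 : ℝ) < s) ∧
        ∃ r : ℝ, 0 < r ∧ ∃ c : ℝ, 0 < c ∧
          ∀ x ∈ Metric.thickening r K, ∃ s ∈ S,
            ENNReal.ofReal c ≤ (M.P s x) (Metric.ball z δ) := by
  intro δ hδ
  obtain ⟨S, hS, c, hc, hev⟩ : ∃ S : Finset ℝ, (∀ s ∈ S, (0 : ℝ) < s) ∧ ∃ c : ℝ, 0 < c ∧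
      ∀ᶠ x in 𝓝ˢ K, ∃ s ∈ S, ENNReal.ofReal c ≤ (M.P s x) (Metric.ball z δ) := by
    refine hKcpt.induction_on (p := fun A => ∃ S : Finset ℝ, (∀ s ∈ S, (0 : ℝ) < s) ∧
      ∃ c : ℝ, 0 < c ∧
        ∀ᶠ x in 𝓝ˢ A, ∃ s ∈ S, ENNReal.ofReal c ≤ (M.P s x) (Metric.ball z δ)) ?_ ?_ ?_ ?_
    · exact ⟨∅, by simp, 1, one_pos, by simp⟩
    · rintro A B hAB ⟨S, hS, c, hc, h⟩
      exact ⟨S, hS, c, hc, h.filter_mono (nhdsSet_mono hAB)⟩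
    · rintro A B ⟨S, hS, c, hc, h⟩ ⟨T, hT, d, hd, h'⟩
      refine ⟨S ∪ T, fun s hs => (Finset.mem_union.1 hs).elim (hS s) (hT s),
        min c d, lt_min hc hd, ?_⟩
      rw [nhdsSet_union, eventually_sup]
      constructor
      · filter_upwards [h] with x ⟨s, hs, hx⟩
        exact ⟨s, Finset.mem_union_left _ hs,
          (ENNReal.ofReal_le_ofReal (min_le_left c d)).trans hx⟩
      · filter_upwards [h'] with x ⟨s, hs, hx⟩
        exact ⟨s, Finset.mem_union_right _ hs,
          (ENNReal.ofReal_le_ofReal (min_le_right c d)).trans hx⟩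
    · intro x hx
      obtain ⟨t, ht, hzt⟩ := hz x hx
      obtain ⟨c, hc, h⟩ := hFeller.exists_eventually_le_measure_ball ht.le hzt hδ
      refine ⟨_, mem_nhdsWithin_of_mem_nhds (eventually_eventually_nhds.2 h),
        {t}, by simpa using ht, c, hc, ?_⟩
      rw [eventually_nhdsSet_iff_forall]
      intro y hy
      simpa using hy
  obtain ⟨U, hU, hKU, h⟩ := eventually_nhdsSet_iff_exists.1 hev
  obtain ⟨r, hr, hrU⟩ := hKcpt.exists_thickening_subset_open hU hKU
  refine ⟨insert 1 S, Finset.insert_nonempty _ _, by simpa using hS, r, hr, c, hc,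
    fun x hx => ?_⟩
  obtain ⟨s, hs, hxs⟩ := h x (hrU hx)
  exact ⟨s, Finset.mem_insert_of_mem hs, hxs⟩
end
end

section
/- Let d ≥ 1 and let γ : ℤ^d \ {0} → (0,∞). (a) If there exist ε, K₀ > 0 such that γ(k) ≥ K₀|k|^{1+ε} for all nonzero k ∈ ℤ^d, then ∫₀^∞ sup_{k∈ℤ^d\{0}} e^{−γ(k)t} |k| dt < ∞; in particular there is a constant C > 0 such that sup_{k∈ℤ^d\{0}} |k| e^{−K₀|k|^{1+ε} t} ≤ C t^{−1/(1+ε)} for all t ∈ (0,1]. (b) Moreover, if m > d/2 + 1, α ∈ (0,1), and ℰ : ℤ^d \ {0} → (nonnegative-definite Hermitian d×d complex matrices) satisfy ∑_{k≠0} γ(k)^α |k|^{2(m+1)} Tr ℰ(k) < ∞, then there exists β ∈ (0,1) such that ∫₀^∞ t^{−β} ∑_{k≠0} |k|^{2(m+1)} γ(k) e^{−2γ(k)t} Tr ℰ(k) dt < ∞. -/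
open MeasureTheory Set ComplexOrder

noncomputable section

/-- Euclidean norm of an integer vector `k ∈ ℤ^d`. -/
def intNorm (d : ℕ) (k : Fin d → ℤ) : ℝ :=
  Real.sqrt (∑ i, ((k i : ℝ)) ^ 2)

/-- A series of nonnegative integrable functions whose integrals are summable is integrable. -/
theorem integrable_tsum_of_nonneg {X ι : Type*} [MeasurableSpace X] {μ : Measure X} [Countable ι]
    {F : ι → X → ℝ} (hF : ∀ i, Integrable (F i) μ) (hF_nonneg : ∀ i, 0 ≤ᵐ[μ] F i)
    (hF_sum : Summable fun i => ∫ x, F i x ∂μ) :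
    Integrable (fun x => ∑' i, F i x) μ := by
  have hmeas : ∀ i, AEMeasurable (fun x => ENNReal.ofReal (F i x)) μ :=
    fun i => (hF i).aemeasurable.ennreal_ofReal
  have hfin : ∫⁻ x, ∑' i, ENNReal.ofReal (F i x) ∂μ ≠ ⊤ := by
    rw [lintegral_tsum hmeas]
    simp_rw [← ofReal_integral_eq_lintegral_ofReal (hF _) (hF_nonneg _)]
    exact hF_sum.tsum_ofReal_ne_top
  refine (integrable_toReal_of_lintegral_ne_top (AEMeasurable.tsum hmeas) hfin).congr ?_
  filter_upwards [ae_all_iff.2 hF_nonneg] with x hx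
  rw [ENNReal.tsum_toReal_eq fun _ => ENNReal.ofReal_ne_top]
  exact tsum_congr fun i => ENNReal.toReal_ofReal (hx i)

theorem one_le_intNorm {d : ℕ} {k : Fin d → ℤ} (hk : k ≠ 0) : 1 ≤ intNorm d k := by
  obtain ⟨i, hi⟩ := Function.ne_iff.1 hk
  rw [intNorm, Real.one_le_sqrt]
  have hi_sq : (1 : ℝ) ≤ (k i : ℝ) ^ 2 := by
    exact_mod_cast Int.add_one_le_of_lt (sq_pos_of_ne_zero hi)
  exact hi_sq.trans
    (Finset.single_le_sum (f := fun j => (k j : ℝ) ^ 2) (fun j _ => sq_nonneg _)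
      (Finset.mem_univ i))

/-- Decay in time of `x * exp (-c * x ^ p * t)`, uniformly in `x`. -/
theorem mul_exp_neg_mul_rpow_le {c p x t : ℝ} (hc : 0 < c) (hp : 1 ≤ p) (hx : 0 ≤ x)
    (ht : 0 < t) :
    x * Real.exp (-(c * x ^ p * t)) ≤ (1 + 1 / c) * t ^ (-(1 / p)) := by
  have hp0 : 0 < p := one_pos.trans_le hp
  set y := x * t ^ (1 / p) with hy
  have hy0 : 0 ≤ y := by positivity
  have hyp : y ^ p = x ^ p * t := by
    rw [hy, Real.mul_rpow hx (by positivity), ← Real.rpow_mul ht.le, one_div_mul_cancel hp0.ne',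
      Real.rpow_one]
  have hle : y ≤ 1 + y ^ p := by
    rcases le_total y 1 with h | h
    · linarith [Real.rpow_nonneg hy0 p]
    · linarith [Real.self_le_rpow_of_one_le h hp]
  have hexp : 1 + y ^ p ≤ (1 + 1 / c) * Real.exp (c * y ^ p) := by
    have hz : 0 ≤ y ^ p := Real.rpow_nonneg hy0 p
    calc 1 + y ^ p ≤ (1 + 1 / c) * (c * y ^ p + 1) := by
          have : (1 + 1 / c) * (c * y ^ p + 1) = 1 + y ^ p + c * y ^ p + 1 / c := by
            field_simp
            ring
          rw [this]
          have : 0 ≤ c * y ^ p + 1 / c := by positivity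
          linarith
      _ ≤ _ := by gcongr; exact Real.add_one_le_exp _
  have hx_eq : x = y * t ^ (-(1 / p)) := by
    rw [hy, mul_assoc, ← Real.rpow_add ht, add_neg_cancel, Real.rpow_zero, mul_one]
  have hy_exp : y * Real.exp (-(c * y ^ p)) ≤ 1 + 1 / c := by
    rw [Real.exp_neg, ← div_eq_mul_inv, div_le_iff₀ (Real.exp_pos _)]
    exact hle.trans hexp
  calc x * Real.exp (-(c * x ^ p * t))
      = y * Real.exp (-(c * y ^ p)) * t ^ (-(1 / p)) := by
        rw [hyp, ← mul_assoc c, mul_right_comm y, ← hx_eq]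
    _ ≤ _ := by gcongr

theorem integrableOn_rpow_mul_exp_neg_mul {s b : ℝ} (hs : -1 < s) (hb : 0 < b) :
    IntegrableOn (fun t : ℝ => t ^ s * Real.exp (-(b * t))) (Ioi 0) := by
  simpa using integrableOn_rpow_mul_exp_neg_mul_rpow hs one_pos hb

theorem integrableOn_iSup_exp_neg_mul_intNorm {d : ℕ} {γ : (Fin d → ℤ) → ℝ} {ε K₀ : ℝ}
    (hε : 0 < ε) (hK₀ : 0 < K₀)
    (hγ : ∀ k : Fin d → ℤ, k ≠ 0 → K₀ * (intNorm d k) ^ (1 + ε) ≤ γ k) :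
    IntegrableOn (fun t : ℝ => ⨆ k : {k : Fin d → ℤ // k ≠ 0},
      Real.exp (-(γ k.1) * t) * intNorm d k.1) (Ioi (0 : ℝ)) := by
  have hs : -1 < -(1 / (1 + ε)) := by
    rw [neg_lt_neg_iff, div_lt_one (by positivity)]
    linarith
  refine Integrable.mono' ((integrableOn_rpow_mul_exp_neg_mul hs (half_pos hK₀)).const_mul
    (1 + 1 / (K₀ / 2))) ?_ ?_
  · exact (Measurable.iSup fun k => by fun_prop).aestronglyMeasurable
  filter_upwards [ae_restrict_mem measurableSet_Ioi] with t (ht : 0 < t)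
  rw [Real.norm_of_nonneg (Real.iSup_nonneg fun k =>
    mul_nonneg (Real.exp_nonneg _) (zero_le_one.trans (one_le_intNorm k.2)))]
  refine Real.iSup_le (fun ⟨k, hk⟩ => ?_) (by positivity)
  have h1 := one_le_intNorm hk
  have hpow : 1 ≤ intNorm d k ^ (1 + ε) := Real.one_le_rpow h1 (by positivity)
  have hexp : -(γ k) * t ≤
      -(K₀ / 2 * intNorm d k ^ (1 + ε) * t) + -(K₀ / 2 * t) := by
    have hγt := mul_le_mul_of_nonneg_right (hγ k hk) ht.le
    have hKt := mul_le_mul_of_nonneg_left hpow (show 0 ≤ K₀ / 2 * t by positivity)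
    linarith
  calc Real.exp (-(γ k) * t) * intNorm d k
      ≤ Real.exp (-(K₀ / 2 * intNorm d k ^ (1 + ε) * t) + -(K₀ / 2 * t)) * intNorm d k := by
        gcongr
    _ = intNorm d k * Real.exp (-(K₀ / 2 * intNorm d k ^ (1 + ε) * t)) *
          Real.exp (-(K₀ / 2 * t)) := by
        rw [Real.exp_add]
        ring
    _ ≤ (1 + 1 / (K₀ / 2)) * t ^ (-(1 / (1 + ε))) * Real.exp (-(K₀ / 2 * t)) := by
        exact mul_le_mul_of_nonneg_right (mul_exp_neg_mul_rpow_le (half_pos hK₀)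
          (le_add_of_nonneg_right hε.le) (zero_le_one.trans h1) ht) (Real.exp_nonneg _)
    _ = _ := mul_assoc _ _ _

/-- The exponential relaxation at rates `2 * g i` turns the weight `g i ^ α` into an integral
against `t ^ (-α)`. -/
theorem integrableOn_rpow_neg_mul_tsum_exp {ι : Type*} [Countable ι] {g a : ι → ℝ} {α : ℝ}
    (hg : ∀ i, 0 < g i) (ha : ∀ i, 0 ≤ a i) (hα : α < 1)
    (hsum : Summable fun i => g i ^ α * a i) :
    IntegrableOn (fun t : ℝ => t ^ (-α) * ∑' i, a i * g i * Real.exp (-(2 * g i * t)))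
      (Ioi (0 : ℝ)) := by
  have hF : ∀ (i : ι) (t : ℝ), t ^ (-α) * (a i * g i * Real.exp (-(2 * g i * t))) =
      a i * g i * (t ^ (-α) * Real.exp (-(2 * g i * t))) := fun i t => by ring
  simp_rw [← tsum_mul_left, hF]
  refine integrable_tsum_of_nonneg (fun i => ?_) (fun i => ?_) ?_
  · exact (integrableOn_rpow_mul_exp_neg_mul (by linarith)
      (mul_pos two_pos (hg i))).const_mul _
  · filter_upwards [ae_restrict_mem measurableSet_Ioi] with t (ht : 0 < t)
    have := hg i
    have := ha i
    simp only [Pi.zero_apply]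
    positivity
  · refine (hsum.mul_left ((1 / 2) ^ (1 - α) * Real.Gamma (1 - α))).congr fun i => ?_
    have hint := Real.integral_rpow_mul_exp_neg_mul_Ioi (sub_pos.2 hα) (mul_pos two_pos (hg i))
    rw [sub_sub_cancel_left] at hint
    have hpow : g i * (1 / (2 * g i)) ^ (1 - α) = (1 / 2) ^ (1 - α) * g i ^ α := by
      have hpos : 0 < g i ^ (1 - α) := Real.rpow_pos_of_pos (hg i) _
      have hinv : g i * (g i ^ (1 - α))⁻¹ = g i ^ α := by
        rw [mul_inv_eq_iff_eq_mul₀ hpos.ne', ← Real.rpow_add (hg i), add_sub_cancel,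
          Real.rpow_one]
      rw [one_div, mul_inv, ← one_div (2 : ℝ), Real.mul_rpow (by norm_num)
        (inv_nonneg.2 (hg i).le), Real.inv_rpow (hg i).le, mul_left_comm, hinv]
    rw [integral_const_mul, hint, mul_assoc (a i), ← mul_assoc (g i), hpow]
    ring

/-- Remark 7 and Lemma 5(i) of the paper.
(a) If `γ(k) ≥ K₀|k|^{1+ε}` for all nonzero `k ∈ ℤ^d`, then
`∫₀^∞ sup_{k≠0} e^{−γ(k)t} |k| dt < ∞`; in particular, there is `C > 0` with
`sup_{k≠0} |k| e^{−K₀|k|^{1+ε} t} ≤ C t^{−1/(1+ε)}` for `t ∈ (0,1]`.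
(b) If `m > d/2 + 1`, `α ∈ (0,1)` and `∑_{k≠0} γ(k)^α |k|^{2(m+1)} Tr ℰ(k) < ∞` for a
family `ℰ` of nonnegative-definite Hermitian matrices, then there is `β ∈ (0,1)` with
`∫₀^∞ t^{−β} ∑_{k≠0} |k|^{2(m+1)} γ(k) e^{−2γ(k)t} Tr ℰ(k) dt < ∞`. -/
theorem mixing_rates_integrability
    (d : ℕ) (hd : 1 ≤ d)
    (γ : (Fin d → ℤ) → ℝ) (hγ : ∀ k : Fin d → ℤ, k ≠ 0 → 0 < γ k) :
    (∀ ε K₀ : ℝ, 0 < ε → 0 < K₀ →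
      (∀ k : Fin d → ℤ, k ≠ 0 → K₀ * (intNorm d k) ^ (1 + ε) ≤ γ k) →
      (MeasureTheory.IntegrableOn
        (fun t : ℝ => ⨆ k : {k : Fin d → ℤ // k ≠ 0},
          Real.exp (-(γ k.1) * t) * intNorm d k.1)
        (Set.Ioi (0 : ℝ))) ∧
      ∃ C : ℝ, 0 < C ∧ ∀ t ∈ Set.Ioc (0 : ℝ) 1, ∀ k : Fin d → ℤ, k ≠ 0 →
        intNorm d k * Real.exp (-(K₀ * (intNorm d k) ^ (1 + ε) * t)) ≤
          C * t ^ (-(1 / (1 + ε))))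
    ∧
    (∀ m α : ℝ, (d : ℝ) / 2 + 1 < m → α ∈ Set.Ioo (0 : ℝ) 1 →
      ∀ E : (Fin d → ℤ) → Matrix (Fin d) (Fin d) ℂ,
      (∀ k : Fin d → ℤ, k ≠ 0 → (E k).PosSemidef) →
      Summable (fun k : {k : Fin d → ℤ // k ≠ 0} =>
        (γ k.1) ^ α * (intNorm d k.1) ^ (2 * (m + 1)) * ((E k.1).trace.re)) →
      ∃ β : ℝ, β ∈ Set.Ioo (0 : ℝ) 1 ∧
        MeasureTheory.IntegrableOn
          (fun t : ℝ => t ^ (-β) *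
            ∑' k : {k : Fin d → ℤ // k ≠ 0},
              (intNorm d k.1) ^ (2 * (m + 1)) * γ k.1 *
                Real.exp (-(2 * γ k.1 * t)) * ((E k.1).trace.re))
          (Set.Ioi (0 : ℝ))) := by
  refine ⟨fun ε K₀ hε hK₀ hK => ⟨integrableOn_iSup_exp_neg_mul_intNorm hε hK₀ hK,
    1 + 1 / K₀, by positivity, fun t ht k hk => ?_⟩, fun m α _ hα E hE hsum => ⟨α, hα, ?_⟩⟩
  · exact mul_exp_neg_mul_rpow_le hK₀ (by linarith) (Real.sqrt_nonneg _) ht.1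
  · have hmain := integrableOn_rpow_neg_mul_tsum_exp
      (g := fun k : {k : Fin d → ℤ // k ≠ 0} => γ k.1)
      (a := fun k => intNorm d k.1 ^ (2 * (m + 1)) * (E k.1).trace.re)
      (fun k => hγ k.1 k.2)
      (fun k => mul_nonneg (Real.rpow_nonneg (Real.sqrt_nonneg _) _)
        (Complex.le_def.1 (hE k.1 k.2).trace_nonneg).1)
      hα.2 (hsum.congr fun k => mul_assoc _ _ _)
    refine hmain.congr_fun (fun t _ => ?_) measurableSet_Ioi
    refine congrArg (t ^ (-α) * ·) (tsum_congr fun k => ?_)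
    ring
end
end
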